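/- Let I ⊆ S be a squarefree monomial ideal with minimal primary decomposition I = I_{α_1} ∩ ⋯ ∩ I_{α_r} satisfying I_{α_1} + ⋯ + I_{α_r} = (x_1,…,x_n), and suppose J_p ≠ 0. Let x^γ be a minimal monomial generator of J_p, let e ≥ 1, q = p^e, and let x^{γ_e} be the minimal monomial generator of J_q corresponding to x^γ (obtained by replacing exponents p−1 by q−1 and p by q). For a ≥ 1 let M_a(γ) be the ideal generated by those minimal monomial generators of J_{p^a} whose support is contained in supp(γ). Then for all integers 1 ≤ β_1,…,β_s < e with β_1 + ⋯ + β_s = e, one has x^{γ_e} ∈ K_{β_1}·K_{β_2}^{[p^{β_1}]}⋯K_{β_s}^{[p^{β_1+⋯+β_{s-1}}]} if and only if x^{γ_e} ∈ M_{β_1}(γ)·(M_{β_2}(γ))^{[p^{β_1}]}⋯(M_{β_s}(γ))^{[p^{β_1+⋯+β_{s-1}}]}. -/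

import Mathlib

noncomputable section

/-- The `q`-th Frobenius power of an ideal: the ideal generated by `{f^q : f ∈ I}`. -/
def frobPow {R : Type*} [CommRing R] (q : ℕ) (I : Ideal R) : Ideal R :=
  Ideal.span ((fun f => f ^ q) '' (I : Set R))

/-- The monomial `x^γ = x_1^{γ_1} ⋯ x_n^{γ_n}` in `k[[x_1,…,x_n]]`. -/
def mon (k : Type*) [Field k] {n : ℕ} (γ : Fin n → ℕ) : MvPowerSeries (Fin n) k :=
  ∏ i, (MvPowerSeries.X i : MvPowerSeries (Fin n) k) ^ γ i

/-- The face ideal `I_α`, generated by the variables `x_i` with `α i = 1`. -/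
def faceIdeal (k : Type*) [Field k] {n : ℕ} (α : Fin n → ℕ) :
    Ideal (MvPowerSeries (Fin n) k) :=
  Ideal.span {f | ∃ i, α i = 1 ∧ f = MvPowerSeries.X i}

/-- `I = I_{α_1} ∩ ⋯ ∩ I_{α_r}` is the minimal primary decomposition of the squarefree
monomial ideal `I` into face ideals: each `α j` is a nonzero `{0,1}`-vector, `I` is the
intersection of the face ideals `I_{α j}`, and the decomposition is irredundant (the
supports of the `α j` are pairwise incomparable). -/
def IsMinFaceDecomp (k : Type*) [Field k] {n r : ℕ} (α : Fin r → Fin n → ℕ)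
    (I : Ideal (MvPowerSeries (Fin n) k)) : Prop :=
  (∀ j i, α j i = 0 ∨ α j i = 1) ∧ (∀ j, α j ≠ 0) ∧
    I = ⨅ j, faceIdeal k (α j) ∧
    ∀ j l, j ≠ l → ¬ ({i | α j i = 1} ⊆ {i | α l i = 1})

/-- `x^γ` is a minimal monomial generator of the monomial ideal `J`: `x^γ ∈ J` and no
monomial properly dividing `x^γ` belongs to `J`. -/
def IsMinGen (k : Type*) [Field k] {n : ℕ} (J : Ideal (MvPowerSeries (Fin n) k))
    (γ : Fin n → ℕ) : Prop :=
  mon k γ ∈ J ∧ ∀ δ : Fin n → ℕ, (∀ i, δ i ≤ γ i) → δ ≠ γ → mon k δ ∉ J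

/-- Replace each entry of `γ` equal to `p` by `q`, each entry equal to `p - 1` by `q - 1`,
and keep the remaining (zero) entries equal to `0`. -/
def scaleExp {n : ℕ} (p q : ℕ) (γ : Fin n → ℕ) : Fin n → ℕ :=
  fun i => if γ i = p then q else if γ i = p - 1 then q - 1 else 0

/-- `J_q`: the unique minimal monomial ideal with
`(I^{[q]} :_S I) = I^{[q]} + J_q + ((x_1⋯x_n)^{q-1})`; equivalently, the ideal generated by
those minimal monomial generators of `(I^{[q]} :_S I)` lying neither in `I^{[q]}` nor in
the principal ideal `((x_1⋯x_n)^{q-1})`. -/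
def Jideal (k : Type*) [Field k] {n : ℕ} (q : ℕ) (I : Ideal (MvPowerSeries (Fin n) k)) :
    Ideal (MvPowerSeries (Fin n) k) :=
  Ideal.span (mon k '' {γ | IsMinGen k ((frobPow q I).colon I) γ ∧
    mon k γ ∉ frobPow q I ∧ mon k γ ∉ Ideal.span {mon k (fun _ => 1) ^ (q - 1)}})

/-- `M_a(γ)`: the ideal generated by the minimal monomial generators of `J_{p^a}` whose
support is contained in the support of `γ`. -/
def Mideal (k : Type*) [Field k] {n : ℕ} (p a : ℕ) (γ : Fin n → ℕ)
    (I : Ideal (MvPowerSeries (Fin n) k)) : Ideal (MvPowerSeries (Fin n) k) :=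
  Ideal.span (mon k '' {δ | IsMinGen k (Jideal k (p ^ a) I) δ ∧
    {i | δ i ≠ 0} ⊆ {i | γ i ≠ 0}})

open MvPowerSeries in
/-- The ideal of power series all of whose exponents lie in the upper set `U`. -/
def supportIdeal {σ : Type*} (R : Type*) [CommRing R] (U : UpperSet (σ →₀ ℕ)) :
    Ideal (MvPowerSeries σ R) where
  carrier := {f | ∀ d, coeff d f ≠ 0 → d ∈ U}
  zero_mem' := by
    intro d hd
    simp at hd
  add_mem' := by
    intro f g hf hg d hd
    by_cases h : coeff d f = 0
    · exact hg d (by simpa [h] using hd)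
    · exact hf d h
  smul_mem' := by
    classical
    intro c f hf d hd
    rw [smul_eq_mul, coeff_mul] at hd
    obtain ⟨x, hx, hne⟩ := Finset.exists_ne_zero_of_sum_ne_zero hd
    refine U.upper ?_ (hf x.2 (right_ne_zero_of_mul hne))
    rw [← Finset.HasAntidiagonal.mem_antidiagonal.1 hx]
    exact le_add_self

section MonomialIdeals

open MvPowerSeries

variable {σ R : Type*} [CommRing R]

lemma monomial_mem_supportIdeal [Nontrivial R] {U : UpperSet (σ →₀ ℕ)} {d : σ →₀ ℕ} :
    monomial d (1 : R) ∈ supportIdeal R U ↔ d ∈ U := by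
  classical
  constructor
  · intro h
    exact h d (by simp)
  · intro h d' hd'
    rw [coeff_monomial] at hd'
    split_ifs at hd' with h'
    · exact h' ▸ h
    · exact absurd rfl hd'

lemma monomial_dvd_monomial {c d : σ →₀ ℕ} (h : c ≤ d) :
    monomial c (1 : R) ∣ monomial d (1 : R) :=
  ⟨monomial (d - c) 1, by rw [monomial_mul_monomial, add_tsub_cancel_of_le h, one_mul]⟩

lemma span_monomial_le_supportIdeal [Nontrivial R] {G : Set (σ →₀ ℕ)} {U : UpperSet (σ →₀ ℕ)}
    (h : ∀ g ∈ G, g ∈ U) :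
    Ideal.span ((fun g => monomial g (1 : R)) '' G) ≤ supportIdeal R U := by
  rw [Ideal.span_le]
  rintro _ ⟨g, hg, rfl⟩
  exact monomial_mem_supportIdeal.2 (h g hg)

lemma exists_le_of_monomial_mem_span [Nontrivial R] {G : Set (σ →₀ ℕ)} {d : σ →₀ ℕ}
    (h : monomial d (1 : R) ∈ Ideal.span ((fun g => monomial g (1 : R)) '' G)) :
    ∃ g ∈ G, g ≤ d := by
  have := span_monomial_le_supportIdeal (R := R) (U := upperClosure G)
    (fun g hg => subset_upperClosure hg) h
  exact mem_upperClosure.1 (monomial_mem_supportIdeal.1 this)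

/-- A power series whose exponents are all bounded below by one of finitely many exponents
is in the ideal generated by the corresponding monomials. -/
lemma mem_span_monomial_of_finite {G : Set (σ →₀ ℕ)} (hG : G.Finite) (f : MvPowerSeries σ R)
    (hf : ∀ d, coeff d f ≠ 0 → ∃ g ∈ G, g ≤ d) :
    f ∈ Ideal.span ((fun g => monomial g (1 : R)) '' G) := by
  classical
  induction G, hG using Set.Finite.induction_on generalizing f with
  | empty =>
    have : f = 0 := by
      ext d
      by_contra h
      obtain ⟨g, hg, -⟩ := hf d h
      exact hg
    simp [this]
  | @insert g G _ _ ih =>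
    let h : MvPowerSeries σ R := fun d => coeff (d + g) f
    have hcoeff : ∀ d, coeff d (monomial g 1 * h) = if g ≤ d then coeff d f else 0 := by
      intro d
      rw [coeff_monomial_mul]
      split_ifs with hd
      · change 1 * coeff (d - g + g) f = _
        rw [one_mul, tsub_add_cancel_of_le hd]
      · rfl
    have hf' : f - monomial g 1 * h ∈ Ideal.span ((fun g => monomial g (1 : R)) '' G) := by
      refine ih _ fun d hd => ?_
      rw [map_sub, hcoeff] at hd
      split_ifs at hd with hgd
      · simp at hd
      · rw [sub_zero] at hd
        obtain ⟨g', hg' | hg', hle⟩ := hf d hd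
        · exact absurd (hg' ▸ hle) hgd
        · exact ⟨g', hg', hle⟩
    rw [← sub_add_cancel f (monomial g 1 * h)]
    refine Ideal.add_mem _ (Ideal.span_mono (Set.image_mono (Set.subset_insert _ _)) hf') ?_
    exact Ideal.mul_mem_right _ _ (Ideal.subset_span ⟨g, Set.mem_insert _ _, rfl⟩)

lemma exists_coeff_ne_zero_of_coeff_pow_ne_zero [Finite σ] (p : ℕ) [ExpChar R p] (m : ℕ)
    {f : MvPowerSeries σ R} {d : σ →₀ ℕ} (h : coeff d (f ^ p ^ m) ≠ 0) :
    ∃ c, coeff c f ≠ 0 ∧ d = p ^ m • c := by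
  have hp : p ≠ 0 := expChar_ne_zero R p
  rw [← map_iterateFrobenius_expand p hp, coeff_map] at h
  have h' : d ∈ Function.support (expand (p ^ m) (pow_ne_zero m hp) f) := by
    intro h0
    exact h (by rw [show coeff d (expand (p ^ m) (pow_ne_zero m hp) f) = 0 from h0, map_zero])
  obtain ⟨c, hc, rfl⟩ := support_expand_subset _ _ _ h'
  exact ⟨c, hc, rfl⟩

lemma frobPow_le_supportIdeal [Finite σ] (p : ℕ) [ExpChar R p] (m : ℕ)
    {I : Ideal (MvPowerSeries σ R)} {U V : UpperSet (σ →₀ ℕ)} (hI : I ≤ supportIdeal R U)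
    (hUV : ∀ d ∈ U, p ^ m • d ∈ V) : frobPow (p ^ m) I ≤ supportIdeal R V := by
  refine Ideal.span_le.2 ?_
  rintro _ ⟨f, hf, rfl⟩ d hd
  obtain ⟨c, hc, rfl⟩ := exists_coeff_ne_zero_of_coeff_pow_ne_zero p m hd
  exact hUV c (hI hf c hc)

lemma exists_sum_le_of_mem_prod {ι : Type*} (s : Finset ι)
    (I : ι → Ideal (MvPowerSeries σ R)) (U : ι → UpperSet (σ →₀ ℕ))
    (hI : ∀ i, I i ≤ supportIdeal R (U i)) {f : MvPowerSeries σ R} (hf : f ∈ ∏ i ∈ s, I i)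
    {d : σ →₀ ℕ} (hd : coeff d f ≠ 0) :
    ∃ m : ι → σ →₀ ℕ, (∀ i ∈ s, m i ∈ U i) ∧ ∑ i ∈ s, m i ≤ d := by
  classical
  induction s using Finset.induction_on generalizing f d with
  | empty => exact ⟨0, by simp, by simp⟩
  | insert a s ha ih =>
    rw [Finset.prod_insert ha] at hf
    induction hf using Submodule.mul_induction_on' with
    | mem_mul_mem g hg h hh =>
      rw [coeff_mul] at hd
      obtain ⟨x, hx, hne⟩ := Finset.exists_ne_zero_of_sum_ne_zero hd
      obtain ⟨m, hm, hle⟩ := ih hh (right_ne_zero_of_mul hne)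
      refine ⟨Function.update m a x.1, ?_, ?_⟩
      · intro i hi
        rcases eq_or_ne i a with rfl | hia
        · rw [Function.update_self]
          exact hI i hg _ (left_ne_zero_of_mul hne)
        · rw [Function.update_of_ne hia]
          exact hm i (Finset.mem_of_mem_insert_of_ne hi hia)
      · rw [Finset.sum_insert ha, Function.update_self, ← Finset.HasAntidiagonal.mem_antidiagonal.1 hx,
          Finset.sum_congr rfl fun i hi =>
            Function.update_of_ne (ne_of_mem_of_not_mem hi ha) x.1 m]
        gcongr
    | add g _ h _ ihg ihh =>
      by_cases h0 : coeff d g = 0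
      · exact ihh (by simpa [h0] using hd)
      · exact ihg h0

lemma exists_sum_smul_le_of_mem_prod_frobPow [Finite σ] (p : ℕ) [ExpChar R p]
    {ι : Type*} (s : Finset ι) (a : ι → ℕ)
    (I : ι → Ideal (MvPowerSeries σ R)) (U : ι → UpperSet (σ →₀ ℕ))
    (hI : ∀ i, I i ≤ supportIdeal R (U i)) {f : MvPowerSeries σ R}
    (hf : f ∈ ∏ i ∈ s, frobPow (p ^ a i) (I i)) {d : σ →₀ ℕ} (hd : coeff d f ≠ 0) :
    ∃ m : ι → σ →₀ ℕ, (∀ i ∈ s, m i ∈ U i) ∧ ∑ i ∈ s, p ^ a i • m i ≤ d := by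
  classical
  obtain ⟨m, hm, hle⟩ := exists_sum_le_of_mem_prod s _
    (fun i => upperClosure ((fun c => p ^ a i • c) '' (U i : Set (σ →₀ ℕ))))
    (fun i => frobPow_le_supportIdeal p (a i) (hI i)
      fun c hc => subset_upperClosure ⟨c, hc, rfl⟩) hf hd
  have : ∀ i, ∃ c : σ →₀ ℕ, i ∈ s → c ∈ U i ∧ p ^ a i • c ≤ m i := by
    intro i
    by_cases hi : i ∈ s
    · obtain ⟨_, ⟨c, hc, rfl⟩, hcm⟩ := mem_upperClosure.1 (hm i hi)
      exact ⟨c, fun _ => ⟨hc, hcm⟩⟩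
    · exact ⟨0, fun h => absurd h hi⟩
  choose c hc using this
  exact ⟨c, fun i hi => (hc i hi).1, (Finset.sum_le_sum fun i hi => (hc i hi).2).trans hle⟩

end MonomialIdeals

lemma mon_eq_monomial (k : Type*) [Field k] {n : ℕ} (γ : Fin n → ℕ) :
    mon k γ = MvPowerSeries.monomial (Finsupp.equivFunOnFinite.symm γ) 1 := by
  unfold mon
  simp only [MvPowerSeries.X_pow_eq]
  rw [MvPowerSeries.prod_monomial, Finset.prod_const_one]
  congr 2
  ext i
  simp [Finsupp.single_apply, Finsupp.finsetSum_apply]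

lemma mon_coe (k : Type*) [Field k] {n : ℕ} (d : Fin n →₀ ℕ) :
    mon k d = MvPowerSeries.monomial d 1 := by
  rw [mon_eq_monomial]
  congr 1
  ext i
  simp

lemma mon_pow (k : Type*) [Field k] {n : ℕ} (γ : Fin n → ℕ) (m : ℕ) :
    mon k γ ^ m = mon k (m • γ) := by
  simp [mon, ← Finset.prod_pow, pow_mul, mul_comm m]

lemma mon_dvd_mon {k : Type*} [Field k] {n : ℕ} {γ δ : Fin n → ℕ} :
    mon k γ ∣ mon k δ ↔ γ ≤ δ := by
  constructor
  · intro h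
    rw [mon_eq_monomial, mon_eq_monomial, ← Ideal.mem_span_singleton] at h
    obtain ⟨g, hg, hle⟩ := exists_le_of_monomial_mem_span (R := k)
      (G := {Finsupp.equivFunOnFinite.symm γ}) (by simpa using h)
    rw [Set.mem_singleton_iff.1 hg] at hle
    exact hle
  · intro h
    rw [mon_eq_monomial, mon_eq_monomial]
    exact monomial_dvd_monomial h

lemma prod_mon (k : Type*) [Field k] {n : ℕ} {ι : Type*} (s : Finset ι) (γ : ι → Fin n → ℕ) :
    ∏ l ∈ s, mon k (γ l) = mon k (∑ l ∈ s, γ l) := by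
  simp only [mon]
  rw [Finset.prod_comm]
  simp [Finset.prod_pow_eq_pow_sum]

lemma exists_le_of_mon_mem_span {k : Type*} [Field k] {n : ℕ} {G : Set (Fin n → ℕ)}
    {γ : Fin n → ℕ} (h : mon k γ ∈ Ideal.span (mon k '' G)) : ∃ g ∈ G, g ≤ γ := by
  have hG : mon k '' G = (fun g => MvPowerSeries.monomial g (1 : k)) ''
      (Finsupp.equivFunOnFinite.symm '' G) := by
    rw [Set.image_image]
    exact Set.image_congr fun g _ => mon_eq_monomial k g
  rw [hG, mon_eq_monomial] at h
  obtain ⟨_, ⟨g, hg, rfl⟩, hle⟩ := exists_le_of_monomial_mem_span h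
  exact ⟨g, hg, hle⟩

/-- Exponents `d` having, on each support of `α j`, some entry at least `q`. -/
def meetExps {n r : ℕ} (α : Fin r → Fin n → ℕ) (q : ℕ) : UpperSet (Fin n →₀ ℕ) where
  carrier := {d | ∀ j, ∃ i, α j i = 1 ∧ q ≤ d i}
  upper' := by
    intro c d hcd hc j
    obtain ⟨i, hi, hq⟩ := hc j
    exact ⟨i, hi, hq.trans (hcd i)⟩

/-- Exponents `d` having, on each support of `α j`, either some entry at least `q` or all
entries at least `q - 1`. -/
def colonExps {n r : ℕ} (α : Fin r → Fin n → ℕ) (q : ℕ) : UpperSet (Fin n →₀ ℕ) where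
  carrier := {d | ∀ j, (∃ i, α j i = 1 ∧ q ≤ d i) ∨ ∀ i, α j i = 1 → q - 1 ≤ d i}
  upper' := by
    intro c d hcd hc j
    rcases hc j with ⟨i, hi, hq⟩ | h
    · exact Or.inl ⟨i, hi, hq.trans (hcd i)⟩
    · exact Or.inr fun i hi => (h i hi).trans (hcd i)

/-- The squarefree exponent marking the entries of `d` that are at least `q`. -/
def thresholdExp {n : ℕ} (q : ℕ) (d : Fin n →₀ ℕ) : Fin n →₀ ℕ :=
  Finsupp.equivFunOnFinite.symm fun i => if q ≤ d i then 1 else 0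

lemma thresholdExp_apply {n : ℕ} (q : ℕ) (d : Fin n →₀ ℕ) (i : Fin n) :
    thresholdExp q d i = if q ≤ d i then 1 else 0 := rfl

lemma thresholdExp_mem {n r : ℕ} {α : Fin r → Fin n → ℕ} {q : ℕ} {d : Fin n →₀ ℕ}
    (hd : d ∈ meetExps α q) : thresholdExp q d ∈ meetExps α 1 := by
  intro j
  obtain ⟨i, hi, hq⟩ := hd j
  exact ⟨i, hi, by simp [thresholdExp_apply, hq]⟩

lemma smul_thresholdExp_le {n : ℕ} (q : ℕ) (d : Fin n →₀ ℕ) : q • thresholdExp q d ≤ d := by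
  intro i
  simp only [Finsupp.smul_apply, thresholdExp_apply, smul_eq_mul]
  split_ifs with h <;> simp [h]

section FaceDecomposition

open MvPowerSeries

variable {k : Type*} [Field k] {n r : ℕ} {α : Fin r → Fin n → ℕ}
  {I : Ideal (MvPowerSeries (Fin n) k)}

lemma IsMinFaceDecomp.le_supportIdeal (h : IsMinFaceDecomp k α I) :
    I ≤ supportIdeal k (meetExps α 1) := by
  classical
  intro f hf d hd j
  let U : UpperSet (Fin n →₀ ℕ) := ⟨{d | ∃ i, α j i = 1 ∧ 1 ≤ d i},
    fun c d hcd ⟨i, hi, h1⟩ => ⟨i, hi, h1.trans (hcd i)⟩⟩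
  have hU : faceIdeal k (α j) ≤ supportIdeal k U := by
    refine Ideal.span_le.2 ?_
    rintro _ ⟨i, hi, rfl⟩
    refine monomial_mem_supportIdeal.2 ⟨i, hi, ?_⟩
    simp
  rw [h.2.2.1] at hf
  exact hU (Ideal.mem_iInf.1 hf j) d hd

lemma IsMinFaceDecomp.monomial_mem (h : IsMinFaceDecomp k α I) {d : Fin n →₀ ℕ}
    (hd : d ∈ meetExps α 1) : monomial d (1 : k) ∈ I := by
  classical
  rw [h.2.2.1, Ideal.mem_iInf]
  intro j
  obtain ⟨i, hi, h1⟩ := hd j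
  refine Ideal.mem_of_dvd _ (monomial_dvd_monomial (c := Finsupp.single i 1) ?_)
    (Ideal.subset_span ⟨i, hi, rfl⟩)
  simpa using h1

lemma IsMinFaceDecomp.frobPow_le (h : IsMinFaceDecomp k α I) (p m : ℕ) [ExpChar k p] :
    frobPow (p ^ m) I ≤ supportIdeal k (meetExps α (p ^ m)) := by
  refine frobPow_le_supportIdeal p m h.le_supportIdeal fun d hd j => ?_
  obtain ⟨i, hi, h1⟩ := hd j
  exact ⟨i, hi, by simpa using Nat.le_mul_of_pos_right _ h1⟩

lemma IsMinFaceDecomp.monomial_mem_frobPow (h : IsMinFaceDecomp k α I) {q : ℕ}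
    {d : Fin n →₀ ℕ} (hd : d ∈ meetExps α q) : monomial d (1 : k) ∈ frobPow q I := by
  refine Ideal.mem_of_dvd _ (monomial_dvd_monomial (smul_thresholdExp_le q d))
    (Ideal.subset_span ⟨_, h.monomial_mem (thresholdExp_mem hd), ?_⟩)
  simp [monomial_pow]

lemma IsMinFaceDecomp.colon_le (h : IsMinFaceDecomp k α I) (p m : ℕ) [ExpChar k p] :
    (frobPow (p ^ m) I).colon I ≤ supportIdeal k (colonExps α (p ^ m)) := by
  classical
  intro f hf d hd j
  by_contra! hcon
  obtain ⟨hlt, i₀, hi₀, hi₀'⟩ := hcon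
  let u : Fin n →₀ ℕ := Finsupp.equivFunOnFinite.symm
    fun i => if i = i₀ ∨ α j i ≠ 1 then 1 else 0
  have hu : ∀ i, u i = if i = i₀ ∨ α j i ≠ 1 then 1 else 0 := fun i => rfl
  have humem : monomial u (1 : k) ∈ I := by
    refine h.monomial_mem fun l => ?_
    rcases eq_or_ne l j with rfl | hlj
    · exact ⟨i₀, hi₀, by simp [hu]⟩
    · obtain ⟨i, hi, hij⟩ := Set.not_subset.1 (h.2.2.2 l j hlj)
      exact ⟨i, hi, by
        rw [hu]
        split_ifs with hc
        · exact le_rfl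
        · exact absurd (Or.inr hij) hc⟩
  have hmem := h.frobPow_le p m (Submodule.mem_colon.1 hf _ humem)
  obtain ⟨i, hi, hq⟩ := hmem (d + u) (by
    rw [smul_eq_mul, coeff_add_mul_monomial, mul_one]; exact hd) j
  rw [Finsupp.add_apply, hu] at hq
  have := hlt i hi
  split_ifs at hq with hc
  · rcases hc with rfl | hc
    · omega
    · exact hc hi
  · omega

lemma IsMinFaceDecomp.monomial_mem_colon (h : IsMinFaceDecomp k α I) {q : ℕ}
    {d : Fin n →₀ ℕ} (hd : d ∈ colonExps α q) :
    monomial d (1 : k) ∈ (frobPow q I).colon I := by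
  rw [Submodule.mem_colon]
  intro f hf
  let G : Set (Fin n →₀ ℕ) := {c | c ∈ meetExps α 1} ∩
    Set.Iic (Finsupp.equivFunOnFinite.symm fun _ => 1)
  have hG : G.Finite := (Set.finite_Iic _).inter_of_right _
  have hfG : f ∈ Ideal.span ((fun g => monomial g (1 : k)) '' G) := by
    refine mem_span_monomial_of_finite hG f fun c hc => ⟨thresholdExp 1 c,
      ⟨thresholdExp_mem (h.le_supportIdeal hf c hc), fun i => ?_⟩, ?_⟩
    · rw [thresholdExp_apply]
      simp only [Finsupp.equivFunOnFinite_symm_apply_apply]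
      split_ifs <;> omega
    · simpa using smul_thresholdExp_le 1 c
  rw [smul_eq_mul]
  clear hf
  induction hfG using Submodule.span_induction with
  | mem x hx =>
    obtain ⟨g, hg, rfl⟩ := hx
    simp only [monomial_mul_monomial, one_mul]
    refine h.monomial_mem_frobPow fun j => ?_
    obtain ⟨i, hi, h1⟩ := hg.1 j
    rcases hd j with ⟨i', hi', hq⟩ | hall
    · exact ⟨i', hi', hq.trans (by simp)⟩
    · refine ⟨i, hi, ?_⟩
      have := hall i hi
      rw [Finsupp.add_apply]
      omega
  | zero => simp
  | add x y _ _ ihx ihy =>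
    rw [mul_add]
    exact Ideal.add_mem _ ihx ihy
  | smul a x _ ihx =>
    rw [smul_eq_mul, mul_left_comm]
    exact Ideal.mul_mem_left _ _ ihx

end FaceDecomposition

/-- If a sum of exponents, scaled by the partial powers of `p`, stays below `p ^ ∑ β` on `A`,
then no summand reaches its own threshold on `A`. -/
lemma lt_pow_of_sum_lt_pow {ι : Type*} (A : Set ι) {p : ℕ} (s : ℕ)
    (β : Fin s → ℕ) (m : Fin s → ι → ℕ)
    (h : ∀ l, (∃ i ∈ A, p ^ β l ≤ m l i) ∨ ∀ i ∈ A, p ^ β l - 1 ≤ m l i)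
    (hlt : ∀ i ∈ A, ∑ l, p ^ (∑ j ∈ Finset.Iio l, β j) * m l i < p ^ ∑ l, β l) (l : Fin s) :
    ∀ i ∈ A, m l i < p ^ β l := by
  induction s with
  | zero => exact l.elim0
  | succ s ih =>
    have hcast : ∀ l : Fin s, ∑ j ∈ Finset.Iio l.castSucc, β j =
        ∑ j ∈ Finset.Iio l, β j.castSucc := by
      intro l
      rw [← Fin.map_castSuccEmb_Iio, Finset.sum_map]
      rfl
    have hlast : ∑ j ∈ Finset.Iio (Fin.last s), β j = ∑ j : Fin s, β j.castSucc := by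
      rw [Fin.Iio_last_eq_map, Finset.sum_map]
      rfl
    simp only [Fin.sum_univ_castSucc, hcast, hlast, pow_add] at hlt
    have hm : ∀ i ∈ A, m (Fin.last s) i < p ^ β (Fin.last s) := by
      intro i hi
      exact lt_of_mul_lt_mul_left ((Nat.le_add_left _ _).trans_lt (hlt i hi)) (Nat.zero_le _)
    have hm' : ∀ i ∈ A, p ^ β (Fin.last s) - 1 ≤ m (Fin.last s) i := by
      rcases h (Fin.last s) with ⟨i, hi, hle⟩ | hall
      · exact absurd (hm i hi) (not_lt.2 hle)
      · exact hall
    induction l using Fin.lastCases with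
    | last => exact hm
    | cast l =>
      refine ih (fun l => β l.castSucc) (fun l => m l.castSucc) (fun l => h l.castSucc) ?_ l
      intro i hi
      have h1 := hlt i hi
      have h2 : p ^ β (Fin.last s) ≤ m (Fin.last s) i + 1 := by
        have := hm' i hi
        omega
      have h3 := Nat.mul_le_mul_left (p ^ ∑ j : Fin s, β j.castSucc) h2
      rw [mul_add, mul_one] at h3
      omega

lemma Jideal_le_colon (k : Type*) [Field k] {n : ℕ} (q : ℕ)
    (I : Ideal (MvPowerSeries (Fin n) k)) : Jideal k q I ≤ (frobPow q I).colon I := by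
  refine Ideal.span_le.2 ?_
  rintro _ ⟨γ, hγ, rfl⟩
  exact hγ.1.1

lemma Mideal_le_Jideal (k : Type*) [Field k] {n : ℕ} (p a : ℕ) (γ : Fin n → ℕ)
    (I : Ideal (MvPowerSeries (Fin n) k)) : Mideal k p a γ I ≤ Jideal k (p ^ a) I := by
  refine Ideal.span_le.2 ?_
  rintro _ ⟨δ, hδ, rfl⟩
  exact hδ.1.1

lemma frobPow_mono {R : Type*} [CommRing R] (q : ℕ) {I J : Ideal R} (h : I ≤ J) :
    frobPow q I ≤ frobPow q J :=
  Ideal.span_mono (Set.image_mono h)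

/-- A minimal generator of an ideal spanned by monomials is one of the spanning monomials. -/
lemma IsMinGen.mem_of_span {k : Type*} [Field k] {n : ℕ} {G : Set (Fin n → ℕ)} {γ : Fin n → ℕ}
    (h : IsMinGen k (Ideal.span (mon k '' G)) γ) : γ ∈ G := by
  obtain ⟨g, hg, hle⟩ := exists_le_of_mon_mem_span h.1
  by_contra hγ
  exact h.2 g hle (fun h' => hγ (h' ▸ hg)) (Ideal.subset_span ⟨g, hg, rfl⟩)

lemma exists_isMinGen_le {k : Type*} [Field k] {n : ℕ} {J : Ideal (MvPowerSeries (Fin n) k)}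
    {γ : Fin n → ℕ} (h : mon k γ ∈ J) : ∃ δ ≤ γ, IsMinGen k J δ := by
  obtain ⟨δ, hle, hδ⟩ := exists_minimal_le_of_wellFoundedLT (fun δ => mon k δ ∈ J) γ h
  exact ⟨δ, hle, hδ.prop, fun c hc hne hmem => hne (le_antisymm hc (hδ.le_of_le hmem hc))⟩

theorem statement8 (p : ℕ) [Fact p.Prime] (k : Type*) [Field k] [CharP k p]
    (n : ℕ) (hn : 0 < n) (r : ℕ) (hr : 0 < r) (α : Fin r → Fin n → ℕ)
    (I : Ideal (MvPowerSeries (Fin n) k)) (hdec : IsMinFaceDecomp k α I)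
    (hsum : (⨆ j, faceIdeal k (α j)) =
      Ideal.span (Set.range (MvPowerSeries.X : Fin n → MvPowerSeries (Fin n) k)))
    (hJp : Jideal k p I ≠ ⊥) (γ : Fin n → ℕ) (hγ : IsMinGen k (Jideal k p I) γ)
    (e : ℕ) (he : 1 ≤ e)
    (hγe : IsMinGen k (Jideal k (p ^ e) I) (scaleExp p (p ^ e) γ))
    (s : ℕ) (β : Fin s → ℕ) (hβ : ∀ i, 1 ≤ β i ∧ β i < e) (hβsum : ∑ i, β i = e) :
    mon k (scaleExp p (p ^ e) γ) ∈
        ∏ i, frobPow (p ^ (∑ j ∈ Finset.Iio i, β j)) ((frobPow (p ^ β i) I).colon I) ↔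
      mon k (scaleExp p (p ^ e) γ) ∈
        ∏ i, frobPow (p ^ (∑ j ∈ Finset.Iio i, β j)) (Mideal k p (β i) γ I) := by
  have hp : p.Prime := Fact.out
  have : ExpChar k p := ExpChar.prime hp
  constructor
  swap
  · refine fun h => (Finset.prod_le_prod' fun i _ => frobPow_mono _ ?_) h
    exact (Mideal_le_Jideal k p (β i) γ I).trans (Jideal_le_colon k _ I)
  intro h
  set c := scaleExp p (p ^ e) γ with hc
  obtain ⟨-, hcI, hcone⟩ := IsMinGen.mem_of_span hγe
  have hcsupp : ∀ i, c i ≠ 0 → γ i ≠ 0 ∧ p ^ e - 1 ≤ c i := by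
    intro i hi
    have := hp.two_le
    simp only [hc, scaleExp] at hi ⊢
    split_ifs at hi ⊢ <;> omega
  obtain ⟨j, hj⟩ : ∃ j, ∀ i, α j i = 1 → c i < p ^ e := by
    by_contra! hcon
    refine hcI ?_
    rw [mon_eq_monomial]
    exact hdec.monomial_mem_frobPow hcon
  obtain ⟨m, hm, hle⟩ := exists_sum_smul_le_of_mem_prod_frobPow p Finset.univ _ _
    (fun i => colonExps α (p ^ β i)) (fun i => hdec.colon_le p (β i)) h
    (d := Finsupp.equivFunOnFinite.symm c) (by rw [mon_eq_monomial]; simp)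
  have hmin : ∀ l, ∃ δ ≤ ⇑(m l), IsMinGen k ((frobPow (p ^ β l) I).colon I) δ := by
    intro l
    refine exists_isMinGen_le ?_
    rw [mon_coe]
    exact hdec.monomial_mem_colon (hm l (Finset.mem_univ l))
  choose δ hδm hδ using hmin
  have hδc : ∀ i, ∑ l, p ^ (∑ j ∈ Finset.Iio l, β j) * δ l i ≤ c i := by
    intro i
    refine (Finset.sum_le_sum fun l _ => Nat.mul_le_mul_left _ (hδm l i)).trans ?_
    simpa [Finsupp.finsetSum_apply] using hle i
  have hδc' : ∀ l i, δ l i ≠ 0 → c i ≠ 0 := by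
    intro l i hl h0
    have h1 := (Finset.sum_eq_zero_iff.1 (Nat.le_zero.1 (h0 ▸ hδc i))) l (Finset.mem_univ l)
    exact (Nat.mul_ne_zero (pow_ne_zero _ hp.ne_zero) hl) h1
  have hδlt := lt_pow_of_sum_lt_pow {i | α j i = 1} s β δ
    (fun l => by
      have := hdec.colon_le p (β l) (hδ l).1
      rw [mon_eq_monomial, monomial_mem_supportIdeal] at this
      exact this j)
    (fun i hi => (hδc i).trans_lt (hβsum ▸ hj i hi))
  have hδM : ∀ l, mon k (δ l) ∈ Mideal k p (β l) γ I := by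
    intro l
    have hgen : mon k (δ l) ∈ Jideal k (p ^ β l) I := by
      refine Ideal.subset_span ⟨δ l, ⟨hδ l, fun hI => ?_, fun hone => ?_⟩, rfl⟩
      · have := hdec.frobPow_le p (β l) hI
        rw [mon_eq_monomial, monomial_mem_supportIdeal] at this
        obtain ⟨i, hi, hq⟩ := this j
        exact absurd (hδlt l i hi) (not_lt.2 hq)
      · rw [mon_pow, Ideal.mem_span_singleton, mon_dvd_mon] at hone
        refine hcone ?_
        rw [mon_pow, Ideal.mem_span_singleton, mon_dvd_mon]
        intro i
        have h1 := hone i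
        have h2 : 1 < p ^ β l := Nat.one_lt_pow (by have := (hβ l).1; omega) hp.one_lt
        simp only [Pi.smul_apply, smul_eq_mul, mul_one] at h1 ⊢
        exact (hcsupp i (hδc' l i (by omega))).2
    exact Ideal.subset_span ⟨δ l, ⟨⟨hgen, fun d hd hne hdJ =>
      (hδ l).2 d hd hne (Jideal_le_colon k _ I hdJ)⟩,
      fun i hi => (hcsupp i (hδc' l i hi)).1⟩, rfl⟩
  have hprod : ∏ l, mon k (δ l) ^ p ^ (∑ j ∈ Finset.Iio l, β j) ∈
      ∏ l, frobPow (p ^ (∑ j ∈ Finset.Iio l, β j)) (Mideal k p (β l) γ I) :=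
    Ideal.prod_mem_prod fun l _ => Ideal.subset_span ⟨_, hδM l, rfl⟩
  refine Ideal.mem_of_dvd _ ?_ hprod
  simp only [mon_pow]
  rw [prod_mon, mon_dvd_mon]
  intro i
  simpa using hδc i


end
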